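/- Let C = P₁ - P₂ be a self-adjoint unitary and V a bounded operator with V†V = 1 (V† = CV*C) such that V₁₂ = P₁VP₂ is Hilbert–Schmidt. Then in the polar decomposition V = V'|V|, the operator |V| - 1 is Hilbert–Schmidt, V' is an isometry, and [P₁, V'] is Hilbert–Schmidt. -/

import Mathlib

open ContinuousLinearMap

/-- `T` is a Hilbert–Schmidt operator. -/
def IsHS {K : Type*} [NormedAddCommGroup K] [InnerProductSpace ℂ K]
    (T : K →L[ℂ] K) : Prop :=
  ∃ (ι : Type) (b : HilbertBasis ι ℂ K), Summable fun i => ‖T (b i)‖ ^ 2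

/-- The conjugate operator `Ā = J A J` of `A` with respect to the conjugation `J`. -/
noncomputable def conjOp {K : Type*} [NormedAddCommGroup K] [InnerProductSpace ℂ K]
    (J : K ≃ₗᵢ⋆[ℂ] K) (A : K →L[ℂ] K) : K →L[ℂ] K :=
  LinearMap.mkContinuous
    { toFun := fun f => J (A (J f))
      map_add' := by intro x y; simp
      map_smul' := by intro c x; simp [map_smulₛₗ] }
    ‖A‖ fun f => by
      calc ‖J (A (J f))‖ = ‖A (J f)‖ := J.norm_map _
        _ ≤ ‖A‖ * ‖J f‖ := A.le_opNorm _
        _ = ‖A‖ * ‖f‖ := by rw [J.norm_map]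

/-- Parseval property of a family. -/
def ParsevalFam {K : Type*} [NormedAddCommGroup K] [InnerProductSpace ℂ K] {ι : Type}
    (e : ι → K) : Prop :=
  ∀ x : K, HasSum (fun i => ‖inner ℂ (e i) x‖ ^ 2) (‖x‖ ^ 2)

theorem parseval_basis {K : Type*} [NormedAddCommGroup K] [InnerProductSpace ℂ K] {ι : Type}
    (b : HilbertBasis ι ℂ K) : ParsevalFam (fun i => b i) := by
  intro x
  have h := b.hasSum_inner_mul_inner x x
  have h2 := Complex.hasSum_re h
  have e1 : (inner ℂ x x).re = ‖x‖ ^ 2 := by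
    have := inner_self_eq_norm_sq (𝕜 := ℂ) x
    simpa using this
  rw [e1] at h2
  convert h2 using 2 with i
  rw [← inner_conj_symm x (b i), ← Complex.normSq_eq_conj_mul_self, Complex.ofReal_re,
    Complex.normSq_eq_norm_sq]

theorem inner_conj_swap {K : Type*} [NormedAddCommGroup K] [InnerProductSpace ℂ K]
    (J : K ≃ₗᵢ⋆[ℂ] K) (x y : K) : ‖inner ℂ (J x) (J y)‖ = ‖inner ℂ x y‖ := by
  have hre : ∀ u v : K, (inner ℂ (J u) (J v)).re = (inner ℂ u v).re := by
    intro u v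
    have h1 := re_inner_eq_norm_add_mul_self_sub_norm_mul_self_sub_norm_mul_self_div_two (𝕜 := ℂ) u v
    have h2 := re_inner_eq_norm_add_mul_self_sub_norm_mul_self_sub_norm_mul_self_div_two (𝕜 := ℂ)
      (J u) (J v)
    rw [← map_add, J.norm_map, J.norm_map, J.norm_map, ← h1] at h2
    exact h2
  have him : (inner ℂ (J x) (J y)).im = - (inner ℂ x y).im := by
    have h := hre (Complex.I • x) y
    rw [map_smulₛₗ, inner_smul_left, inner_smul_left] at h
    simp at h
    linarith
  have h0 := hre x y
  rw [← sq_eq_sq₀ (norm_nonneg _) (norm_nonneg _), ← Complex.normSq_eq_norm_sq,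
    ← Complex.normSq_eq_norm_sq, Complex.normSq_apply, Complex.normSq_apply, h0, him]
  ring

theorem parseval_conj {K : Type*} [NormedAddCommGroup K] [InnerProductSpace ℂ K] {ι : Type}
    (J : K ≃ₗᵢ⋆[ℂ] K) (hJ : ∀ f, J (J f) = f) (e : ι → K) (he : ParsevalFam e) :
    ParsevalFam (fun i => J (e i)) := by
  intro x
  have h := he (J x)
  rw [J.norm_map] at h
  convert h using 2 with i
  have := inner_conj_swap J (e i) (J x)
  rw [hJ] at this
  rw [this]

/-- Square summability along a family. -/
def HSb {K : Type*} [NormedAddCommGroup K] [InnerProductSpace ℂ K] {ι : Type}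
    (e : ι → K) (T : K →L[ℂ] K) : Prop := Summable fun i => ‖T (e i)‖ ^ 2

section
variable {K : Type*} [NormedAddCommGroup K] [InnerProductSpace ℂ K] [CompleteSpace K] {ι : Type}

theorem HSb.star {e f : ι → K} (he : ParsevalFam e) (hf : ParsevalFam f) {T : K →L[ℂ] K}
    (h : HSb e T) : HSb f (star T) := by
  have hs : Summable (fun p : ι × ι => ‖inner ℂ (f p.2) (T (e p.1))‖ ^ 2) := by
    rw [summable_prod_of_nonneg (fun p => sq_nonneg _)]
    refine ⟨fun i => (hf (T (e i))).summable, ?_⟩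
    refine Summable.congr h fun i => ?_
    exact (hf (T (e i))).tsum_eq.symm
  have hs2 := hs.prod_symm
  rw [summable_prod_of_nonneg (fun p => sq_nonneg _)] at hs2
  have h3 := hs2.2
  unfold HSb
  refine Summable.congr h3 fun j => ?_
  rw [← (he (Star.star T (f j))).tsum_eq]
  refine tsum_congr fun i => ?_
  rw [star_eq_adjoint, adjoint_inner_right, norm_inner_symm (T (e i))]
  rfl

theorem HSb.left {e : ι → K} {T : K →L[ℂ] K} (S : K →L[ℂ] K) (h : HSb e T) :
    HSb e (S * T) := by
  refine Summable.of_nonneg_of_le (fun i => by positivity) (fun i => ?_) (h.mul_left (‖S‖ ^ 2))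
  rw [← mul_pow]
  exact pow_le_pow_left₀ (norm_nonneg _) (S.le_opNorm _) 2

theorem HSb.right {e : ι → K} (he : ParsevalFam e) {T : K →L[ℂ] K} (S : K →L[ℂ] K)
    (h : HSb e T) : HSb e (T * S) := by
  have := HSb.star he he ((HSb.star he he h).left (Star.star S))
  simpa using this

theorem HSb.add {e : ι → K} {T S : K →L[ℂ] K} (h : HSb e T) (h' : HSb e S) :
    HSb e (T + S) := by
  refine Summable.of_nonneg_of_le (fun i => by positivity) (fun i => ?_)
    ((Summable.add h h').mul_left 2)
  have h1 : ‖(T + S) (e i)‖ ≤ ‖T (e i)‖ + ‖S (e i)‖ := norm_add_le _ _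
  have h2 := pow_le_pow_left₀ (norm_nonneg _) h1 2
  nlinarith [sq_nonneg (‖T (e i)‖ - ‖S (e i)‖)]

theorem HSb.neg {e : ι → K} {T : K →L[ℂ] K} (h : HSb e T) : HSb e (-T) := by
  simpa [HSb] using h

theorem HSb.sub {e : ι → K} {T S : K →L[ℂ] K} (h : HSb e T) (h' : HSb e S) :
    HSb e (T - S) := by
  rw [sub_eq_add_neg]; exact h.add h'.neg

end

/-- For a CCR Bogoliubov operator `V` (`V†V = 1`, `V† = CV*C`) with `V₁₂ = P₁V(1-P₁)`
Hilbert–Schmidt, in the polar decomposition `V = V'|V|` the operator `|V| - 1` is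
Hilbert–Schmidt, `V'` is an isometry, and `[P₁, V']` is Hilbert–Schmidt. -/
theorem stmt13 {K : Type*} [NormedAddCommGroup K] [InnerProductSpace ℂ K] [CompleteSpace K]
    (J : K ≃ₗᵢ⋆[ℂ] K) (hJ : ∀ f, J (J f) = f)
    (P₁ : K →L[ℂ] K) (hP₁sa : IsSelfAdjoint P₁) (hP₁idem : P₁ ∘L P₁ = P₁)
    (hP₁conj : conjOp J P₁ = 1 - P₁)
    (C : K →L[ℂ] K) (hC : C = P₁ - (1 - P₁))
    (V : K →L[ℂ] K) (hV : (C ∘L adjoint V ∘L C) ∘L V = 1) (hVconj : conjOp J V = V)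
    (hHS : IsHS (P₁ ∘L V ∘L (1 - P₁)))
    -- polar decomposition `V = V' A` with `A = |V|`:
    (A V' : K →L[ℂ] K) (hA : A ∘L A = adjoint V ∘L V) (hApos : A.IsPositive)
    (hpolar : V = V' ∘L A) (hV'ker : ∀ x, A x = 0 → V' x = 0) :
    IsHS (A - 1) ∧ adjoint V' ∘L V' = 1 ∧ IsHS (P₁ ∘L V' - V' ∘L P₁) := by
  obtain ⟨ι, b, hb⟩ := hHS
  have he := parseval_basis b
  set e : ι → K := fun i => b i with hedef
  have h12 : HSb e (P₁ * V * (1 - P₁)) := hb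
  have key : ∀ T : K →L[ℂ] K, HSb e T → IsHS T := fun T h => ⟨ι, b, h⟩
  have hP : P₁ * P₁ = P₁ := hP₁idem
  have sP : star P₁ = P₁ := hP₁sa
  have cP : ∀ x, J (P₁ (J x)) = x - P₁ x := fun x => congrArg (fun T : K →L[ℂ] K => T x) hP₁conj
  have cV : ∀ x, J (V (J x)) = V x := fun x => congrArg (fun T : K →L[ℂ] K => T x) hVconj
  -- the other off-diagonal block
  have h21 : HSb e ((1 - P₁) * V * P₁) := by
    have h1 : HSb (fun i => J (e i)) (P₁ * V * (1 - P₁)) := by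
      have := HSb.star he (parseval_conj J hJ e he) (HSb.star he he h12)
      rwa [star_star] at this
    unfold HSb at h1 ⊢
    convert h1 using 3 with i
    have e2 : ((1 - P₁) * V * P₁) (e i) = J ((P₁ * V * (1 - P₁)) (J (e i))) := by
      have q1 : ∀ x, J x - P₁ (J x) = J (P₁ x) := fun x => by rw [← cP (J x), hJ]
      have q2 : ∀ x, V (J x) = J (V x) := fun x => by rw [← cV (J x), hJ]
      change V (P₁ (e i)) - P₁ (V (P₁ (e i))) = J (P₁ (V (J (e i) - P₁ (J (e i)))))
      rw [q1, q2, ← cP]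
    rw [e2, J.norm_map]
  have hV2 : (C * star V * C) * V = 1 := hV
  have sC : star C = C := by rw [hC]; simp [sP]
  have hAA : A * A = star V * V := hA
  have sA : star A = A := hApos.isSelfAdjoint
  have hpol : V = V' * A := hpolar
  -- inverse of A
  obtain ⟨B, hBA, hAB⟩ : ∃ B : K →L[ℂ] K, B * A = 1 ∧ A * B = 1 := by
    have hL : (C * star V * C * V') * A = 1 := by rw [mul_assoc, ← hpol, hV2]
    have hR : A * star (C * star V * C * V') = 1 := by
      have := congrArg star hL
      rwa [star_mul, sA, star_one] at this
    refine ⟨_, hL, ?_⟩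
    rwa [← left_inv_eq_right_inv hL hR] at hR
  have sB : star B = B := by
    have h1 : star B * A = 1 := by
      have := congrArg star hAB
      rwa [star_mul, sA, star_one] at this
    exact left_inv_eq_right_inv h1 hAB
  have hV' : V' = V * B := by rw [hpol, mul_assoc, hAB, mul_one]
  obtain ⟨D, hD⟩ : ∃ D : K →L[ℂ] K, (A + 1) * D = 1 := by
    have h0 : (0 : K →L[ℂ] K) ≤ A := (ContinuousLinearMap.nonneg_iff_isPositive A).2 hApos
    have hu : IsUnit (A + 1) := CStarAlgebra.isUnit_of_le (1 : K →L[ℂ] K) (le_add_of_nonneg_left h0)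
      (IsStrictlyPositive.iff_of_unital.2 ⟨zero_le_one, isUnit_one⟩)
    exact hu.exists_right_inv
  have hX : HSb e (A * A - 1) := by
    have hs := ((HSb.star he he h12).add (HSb.star he he h21)).right he V
    have : A * A - 1 = (star (P₁ * V * (1 - P₁)) + star ((1 - P₁) * V * P₁)) * V
        + (star (P₁ * V * (1 - P₁)) + star ((1 - P₁) * V * P₁)) * V := by
      have h3 : A * A - 1 = star V * V - C * star V * C * V := by rw [hAA, hV2]
      rw [h3, hC]
      simp only [star_mul, star_sub, star_one, sP]
      noncomm_ring
    rw [this]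
    exact hs.add hs
  have hA1 : HSb e (A - 1) := by
    have : A - 1 = (A * A - 1) * D := by
      rw [show A * A - 1 = (A - 1) * (A + 1) by noncomm_ring, mul_assoc, hD, mul_one]
    rw [this]
    exact hX.right he D
  refine ⟨key _ hA1, ?_, key _ ?_⟩
  · change star V' * V' = 1
    rw [hV', star_mul, sB]
    calc B * star V * (V * B) = B * (star V * V) * B := by noncomm_ring
      _ = (B * A) * (A * B) := by rw [← hAA]; noncomm_ring
      _ = 1 := by rw [hBA, hAB, one_mul]
  · change HSb e (P₁ * V' - V' * P₁)
    have hc : P₁ * B - B * P₁ = B * ((A - 1) * P₁ - P₁ * (A - 1)) * B := by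
      calc P₁ * B - B * P₁ = (B * A) * P₁ * B - B * P₁ * (A * B) := by
            rw [hBA, hAB, one_mul, mul_one]
        _ = _ := by noncomm_ring
    have : P₁ * V' - V' * P₁ = (P₁ * V * (1 - P₁) - (1 - P₁) * V * P₁) * B
        + V * (B * ((A - 1) * P₁ - P₁ * (A - 1)) * B) := by
      rw [← hc, hV']; noncomm_ring
    rw [this]
    exact ((h12.sub h21).right he B).add
      (HSb.left V (((((hA1.right he P₁).sub (hA1.left P₁)).left B)).right he B))
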